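/- arXiv:2603.08350 — 9 statements merged into one kernel-verified Lean document; each statement's English description precedes it below -/
import Mathlib

section
/- Algebraic p-Picone inequality (Allegretto–Huang): Let E be a real inner product space, let p > 1 be a real number, let a, b ∈ E with b ≠ 0, and let t be a real number with t ≥ 0. Then ‖a‖^p + (p − 1) · t^p · ‖b‖^p − p · t^(p−1) · ‖b‖^(p−2) · ⟪a, b⟫ ≥ 0. -/
open RealInnerProductSpace

/-- Young's inequality in the form `p x y ^ (p - 1) ≤ x ^ p + (p - 1) y ^ p`. -/
theorem mul_mul_rpow_sub_one_le {p x y : ℝ} (hp : 1 < p) (hx : 0 ≤ x) (hy : 0 ≤ y) :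
    p * (x * y ^ (p - 1)) ≤ x ^ p + (p - 1) * y ^ p := by
  have hp₀ : p ≠ 0 := by linarith
  have hp₁ : p - 1 ≠ 0 := by linarith
  have young := Real.young_inequality_of_nonneg hx (Real.rpow_nonneg hy (p - 1))
    (Real.HolderConjugate.conjExponent hp)
  rw [Real.conjExponent, ← Real.rpow_mul hy, mul_div_cancel₀ p hp₁] at young
  calc p * (x * y ^ (p - 1)) ≤ p * (x ^ p / p + y ^ p / (p / (p - 1))) := by gcongr
    _ = x ^ p + (p - 1) * y ^ p := by field_simp

/-- Algebraic p-Picone inequality (Allegretto–Huang). -/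
theorem algebraic_p_picone {E : Type*} [NormedAddCommGroup E] [InnerProductSpace ℝ E]
    (p : ℝ) (hp : 1 < p) (a b : E) (hb : b ≠ 0) (t : ℝ) (ht : 0 ≤ t) :
    ‖a‖ ^ p + (p - 1) * t ^ p * ‖b‖ ^ p - p * t ^ (p - 1) * ‖b‖ ^ (p - 2) * ⟪a, b⟫ ≥ 0 := by
  have hb' : 0 < ‖b‖ := norm_pos_iff.mpr hb
  have young := mul_mul_rpow_sub_one_le hp (norm_nonneg a) (mul_nonneg ht hb'.le)
  rw [Real.mul_rpow ht hb'.le, Real.mul_rpow ht hb'.le] at young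
  have hpow : ‖b‖ ^ (p - 1) = ‖b‖ ^ (p - 2) * ‖b‖ := by
    rw [← Real.rpow_add_one hb'.ne']
    ring_nf
  have cauchy : p * t ^ (p - 1) * ‖b‖ ^ (p - 2) * ⟪a, b⟫ ≤
      p * t ^ (p - 1) * ‖b‖ ^ (p - 2) * (‖a‖ * ‖b‖) := by
    gcongr
    exact real_inner_le_norm a b
  rw [hpow] at young
  linarith
end

section
/- Equality case of the algebraic p-Picone inequality: Let E be a real inner product space, let p > 1 be a real number, let a, b ∈ E with b ≠ 0, and let t be a real number with t ≥ 0. Then ‖a‖^p + (p − 1) · t^p · ‖b‖^p − p · t^(p−1) · ‖b‖^(p−2) · ⟪a, b⟫ = 0 if and only if a = t • b. -/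
open RealInnerProductSpace

/-- Strict tangent-line (Young) inequality for `x ↦ x ^ p` on the nonnegative reals. -/
theorem Real.mul_rpow_sub_one_mul_lt_of_ne {p x y : ℝ} (hp : 1 < p) (hx : 0 ≤ x) (hy : 0 ≤ y)
    (hxy : x ≠ y) : p * y ^ (p - 1) * x < x ^ p + (p - 1) * y ^ p := by
  rcases hy.eq_or_lt with rfl | hy
  · have hx' : 0 < x := lt_of_le_of_ne hx hxy.symm
    rw [Real.zero_rpow (by linarith), Real.zero_rpow (by linarith)]
    simpa using Real.rpow_pos_of_pos hx' p
  · have hne : x / y - 1 ≠ 0 := by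
      rw [sub_ne_zero, Ne, div_eq_one_iff_eq hy.ne']
      exact hxy
    have hge : -1 ≤ x / y - 1 := by linarith [div_nonneg hx hy.le]
    have bernoulli := one_add_mul_self_lt_rpow_one_add hge hne hp
    rw [add_sub_cancel, Real.div_rpow hx hy.le, lt_div_iff₀ (Real.rpow_pos_of_pos hy p)]
      at bernoulli
    have hpow : y ^ p = y ^ (p - 1) * y := by
      rw [← Real.rpow_add_one hy.ne', sub_add_cancel]
    have hmul : x / y * y ^ p = y ^ (p - 1) * x := by
      rw [hpow]
      field_simp
    linear_combination bernoulli - p * hmul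

/-- Equality case of the algebraic p-Picone inequality. -/
theorem algebraic_p_picone_eq {E : Type*} [NormedAddCommGroup E] [InnerProductSpace ℝ E]
    (p : ℝ) (hp : 1 < p) (a b : E) (hb : b ≠ 0) (t : ℝ) (ht : 0 ≤ t) :
    ‖a‖ ^ p + (p - 1) * t ^ p * ‖b‖ ^ p - p * t ^ (p - 1) * ‖b‖ ^ (p - 2) * ⟪a, b⟫ = 0 ↔
      a = t • b := by
  rcases ht.eq_or_lt with rfl | ht'
  · rw [Real.zero_rpow (by linarith), Real.zero_rpow (by linarith)]
    simp [Real.rpow_eq_zero (norm_nonneg a) (by linarith : p ≠ 0)]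
  have hb' : 0 < ‖b‖ := norm_pos_iff.mpr hb
  have hy : 0 < t * ‖b‖ := mul_pos ht' hb'
  have hpow : (t * ‖b‖) ^ (p - 1) = t ^ (p - 1) * (‖b‖ ^ (p - 2) * ‖b‖) := by
    rw [Real.mul_rpow ht hb'.le, ← Real.rpow_add_one hb'.ne']
    ring_nf
  have hsplit : ‖a‖ ^ p + (p - 1) * t ^ p * ‖b‖ ^ p
        - p * t ^ (p - 1) * ‖b‖ ^ (p - 2) * ⟪a, b⟫
      = (‖a‖ ^ p + (p - 1) * (t * ‖b‖) ^ p - p * (t * ‖b‖) ^ (p - 1) * ‖a‖)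
        + p * t ^ (p - 1) * ‖b‖ ^ (p - 2) * (‖a‖ * ‖b‖ - ⟪a, b⟫) := by
    rw [hpow, Real.mul_rpow ht hb'.le]
    ring
  have hyoung : ‖a‖ = t * ‖b‖ →
      ‖a‖ ^ p + (p - 1) * (t * ‖b‖) ^ p - p * (t * ‖b‖) ^ (p - 1) * ‖a‖ = 0 := by
    intro h
    have hpow' : (t * ‖b‖) ^ p = (t * ‖b‖) ^ (p - 1) * (t * ‖b‖) := by
      rw [← Real.rpow_add_one hy.ne', sub_add_cancel]
    rw [h, hpow']
    ring
  have hcoef : 0 < p * t ^ (p - 1) * ‖b‖ ^ (p - 2) := by positivity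
  have hcs : 0 ≤ ‖a‖ * ‖b‖ - ⟪a, b⟫ := sub_nonneg.mpr (real_inner_le_norm a b)
  rw [hsplit]
  constructor
  · intro h
    have hnorm : ‖a‖ = t * ‖b‖ := by
      by_contra hne
      have := Real.mul_rpow_sub_one_mul_lt_of_ne hp (norm_nonneg a) hy.le hne
      linarith [mul_nonneg hcoef.le hcs]
    rw [hyoung hnorm, zero_add] at h
    have hinner := (mul_eq_zero.mp h).resolve_left hcoef.ne'
    have hsq : ‖a - t • b‖ ^ 2 = 0 := by
      rw [norm_sub_sq_real, real_inner_smul_right, norm_smul, Real.norm_of_nonneg ht]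
      linear_combination 2 * t * hinner + (‖a‖ - t * ‖b‖) * hnorm
    exact sub_eq_zero.mp (norm_eq_zero.mp (pow_eq_zero_iff two_ne_zero |>.mp hsq))
  · intro h
    have hnorm : ‖a‖ = t * ‖b‖ := by rw [h, norm_smul, Real.norm_of_nonneg ht]
    have hinner : ⟪a, b⟫ = ‖a‖ * ‖b‖ := by
      rw [hnorm, h, real_inner_smul_left, real_inner_self_eq_norm_sq]
      ring
    rw [hyoung hnorm, hinner]
    ring
end

section
/- Pointwise Picone identity for the p-Laplacian: Let E be a real inner product space, let p > 1 be a real number, let u, v : E → ℝ, and let x ∈ E. Assume u and v are differentiable at x with u(x) > 0 and v(x) > 0. Then the function w := fun y => (u y)^p / (v y)^(p−1) is differentiable at x, and ‖∇u(x)‖^p − ‖∇v(x)‖^(p−2) · ⟪∇v(x), ∇w(x)⟫ = ‖∇u(x)‖^p + (p − 1) · (u(x)/v(x))^p · ‖∇v(x)‖^p − p · (u(x)/v(x))^(p−1) · ‖∇v(x)‖^(p−2) · ⟪∇u(x), ∇v(x)⟫. -/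
open RealInnerProductSpace

/-- Gradient of the Picone test function `u ^ p / v ^ (p - 1)` at a point where both functions
are positive. -/
theorem hasGradientAt_rpow_div_rpow_sub_one {E : Type*} [NormedAddCommGroup E]
    [InnerProductSpace ℝ E] [CompleteSpace E] (p : ℝ) {u v : E → ℝ} {u' v' x : E}
    (hu : HasGradientAt u u' x) (hv : HasGradientAt v v' x) (hux : 0 < u x) (hvx : 0 < v x) :
    HasGradientAt (fun y => (u y) ^ p / (v y) ^ (p - 1))
      ((p * (u x / v x) ^ (p - 1)) • u' - ((p - 1) * (u x / v x) ^ p) • v') x := by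
  rw [hasGradientAt_iff_hasFDerivAt] at hu hv ⊢
  have hv0 : v x ^ (p - 1) ≠ 0 := (Real.rpow_pos_of_pos hvx _).ne'
  have hinv := (hasDerivAt_inv hv0).comp_hasFDerivAt x
    (hv.rpow_const (p := p - 1) (Or.inl hvx.ne'))
  simp only [div_eq_mul_inv (_ ^ p)]
  refine ((hu.rpow_const (p := p) (Or.inl hux.ne')).mul hinv).congr_fderiv ?_
  ext z
  simp only [map_sub, map_smul, Function.comp_apply, add_apply,
    sub_apply, smul_apply,
    smul_eq_mul, Real.div_rpow hux.le hvx.le, Real.rpow_sub_one hux.ne', Real.rpow_sub_one hvx.ne']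
  have hvp : v x ^ p ≠ 0 := (Real.rpow_pos_of_pos hvx _).ne'
  field_simp
  ring

theorem norm_rpow_sub_two_mul_norm_sq {E : Type*} [NormedAddCommGroup E] {p : ℝ} (hp : p ≠ 0)
    (a : E) : ‖a‖ ^ (p - 2) * ‖a‖ ^ 2 = ‖a‖ ^ p := by
  rcases eq_or_ne a 0 with rfl | ha
  · simp [Real.zero_rpow hp]
  · rw [← Real.rpow_natCast, ← Real.rpow_add (norm_pos_iff.2 ha)]
    norm_num

/-- Pointwise Picone identity for the p-Laplacian. -/
theorem pointwise_picone_identity {E : Type*} [NormedAddCommGroup E] [InnerProductSpace ℝ E]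
    [CompleteSpace E] (p : ℝ) (hp : 1 < p) (u v : E → ℝ) (x : E)
    (hu : DifferentiableAt ℝ u x) (hv : DifferentiableAt ℝ v x)
    (hux : 0 < u x) (hvx : 0 < v x) :
    DifferentiableAt ℝ (fun y => (u y) ^ p / (v y) ^ (p - 1)) x ∧
      ‖gradient u x‖ ^ p -
          ‖gradient v x‖ ^ (p - 2) *
            ⟪gradient v x, gradient (fun y => (u y) ^ p / (v y) ^ (p - 1)) x⟫ =
        ‖gradient u x‖ ^ p + (p - 1) * (u x / v x) ^ p * ‖gradient v x‖ ^ p -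
          p * (u x / v x) ^ (p - 1) * ‖gradient v x‖ ^ (p - 2) *
            ⟪gradient u x, gradient v x⟫ := by
  have hw := hasGradientAt_rpow_div_rpow_sub_one p hu.hasGradientAt hv.hasGradientAt hux hvx
  refine ⟨hw.differentiableAt, ?_⟩
  rw [hw.gradient, inner_sub_right, real_inner_smul_right, real_inner_smul_right,
    real_inner_self_eq_norm_sq, real_inner_comm,
    ← norm_rpow_sub_two_mul_norm_sq (by linarith : p ≠ 0) (gradient v x)]
  ring
end

section
/- Euclidean p-Barta inequality (Euclidean case of Theorem 1.2): Let n ≥ 1, let Ω ⊆ E = EuclideanSpace ℝ (Fin n) be open, and let p > 1 be real. Let η : E → ℝ be continuously differentiable on Ω with η(x) > 0 for all x ∈ Ω, and suppose the vector field V := fun y => ‖∇η y‖^(p−2) • ∇η y is differentiable at every point of Ω with divergence div V continuous on Ω. Let λ ∈ ℝ satisfy −div V x ≥ λ · (η x)^(p−1) for all x ∈ Ω. Then for every smooth function φ : E → ℝ with compact support contained in Ω and φ ≥ 0 everywhere, ∫_Ω ‖∇φ x‖^p dx ≥ λ · ∫_Ω (φ x)^p dx, where the integrals are with respect to Lebesgue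 measure. -/
open RealInnerProductSpace MeasureTheory

/-- The divergence of a vector field: the trace of its Fréchet derivative. -/
noncomputable def vdiv {n : ℕ} (X : EuclideanSpace ℝ (Fin n) → EuclideanSpace ℝ (Fin n))
    (x : EuclideanSpace ℝ (Fin n)) : ℝ :=
  LinearMap.trace ℝ (EuclideanSpace ℝ (Fin n)) (fderiv ℝ X x).toLinearMap

/-- The divergence in Cartesian coordinates. -/
theorem vdiv_eq_sum {n : ℕ} (X : EuclideanSpace ℝ (Fin n) → EuclideanSpace ℝ (Fin n))
    (x : EuclideanSpace ℝ (Fin n)) :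
    vdiv X x = ∑ i, fderiv ℝ X x (EuclideanSpace.single i 1) i := by
  simp [vdiv, LinearMap.trace_eq_sum_inner _ (EuclideanSpace.basisFun (Fin n) ℝ),
    EuclideanSpace.inner_single_left]

/-- The product rule for the divergence of a scalar multiple of a vector field. -/
theorem vdiv_smul {n : ℕ} {f : EuclideanSpace ℝ (Fin n) → ℝ}
    {X : EuclideanSpace ℝ (Fin n) → EuclideanSpace ℝ (Fin n)} {x : EuclideanSpace ℝ (Fin n)}
    (hf : DifferentiableAt ℝ f x) (hX : DifferentiableAt ℝ X x) :
    vdiv (fun y => f y • X y) x = f x * vdiv X x + fderiv ℝ f x (X x) := by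
  have h : (fderiv ℝ (fun y => f y • X y) x).toLinearMap =
      f x • (fderiv ℝ X x).toLinearMap + (fderiv ℝ f x).toLinearMap.smulRight (X x) := by
    rw [fderiv_fun_smul hf hX]
    rfl
  rw [vdiv, h, map_add, map_smul, LinearMap.trace_smulRight, smul_eq_mul]
  rfl

theorem vdiv_eq_zero_of_notMem_tsupport {n : ℕ}
    {X : EuclideanSpace ℝ (Fin n) → EuclideanSpace ℝ (Fin n)} {x : EuclideanSpace ℝ (Fin n)}
    (hx : x ∉ tsupport X) : vdiv X x = 0 := by
  rw [vdiv, fderiv_of_notMem_tsupport ℝ hx]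
  simp

/-- The integral of the divergence of a compactly supported differentiable vector field vanishes,
provided that the divergence is integrable. -/
theorem integral_vdiv_eq_zero {n : ℕ} (hn : 1 ≤ n)
    {X : EuclideanSpace ℝ (Fin n) → EuclideanSpace ℝ (Fin n)} (hX : Differentiable ℝ X)
    (hsupp : HasCompactSupport X) (hint : Integrable (fun x => vdiv X x)) :
    ∫ x, vdiv X x = 0 := by
  obtain ⟨m, rfl⟩ : ∃ m, n = m + 1 := ⟨n - 1, by omega⟩
  obtain ⟨R, hR⟩ := hsupp.isCompact.isBounded.exists_norm_le
  have hvanish : ∀ y, ∀ i, R < |y i| → X y = 0 := by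
    intro y i hy
    by_contra hne
    have h1 := hR y (subset_tsupport _ hne)
    have h2 := PiLp.norm_apply_le y i
    rw [Real.norm_eq_abs] at h2
    linarith
  have hdivvanish : ∀ y, ∀ i, R < |y i| → vdiv X y = 0 := by
    intro y i hy
    apply vdiv_eq_zero_of_notMem_tsupport
    intro hmem
    have h1 := hR y hmem
    have h2 := PiLp.norm_apply_le y i
    rw [Real.norm_eq_abs] at h2
    linarith
  let L := EuclideanSpace.equiv (Fin (m + 1)) ℝ
  have hmp := PiLp.volume_preserving_toLp (Fin (m + 1))
  have hemb := (MeasurableEquiv.toLp 2 (Fin (m + 1) → ℝ)).measurableEmbedding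
  let S := |R| + 1
  have hS : R < S := by have := le_abs_self R; simp only [S]; linarith
  have hS0 : 0 < S := by positivity
  let f' : (Fin (m + 1) → ℝ) → (Fin (m + 1) → ℝ) →L[ℝ] (Fin (m + 1) → ℝ) := fun x =>
    (L : EuclideanSpace ℝ (Fin (m + 1)) →L[ℝ] (Fin (m + 1) → ℝ)).comp
      ((fderiv ℝ X (L.symm x)).comp
        (L.symm : (Fin (m + 1) → ℝ) →L[ℝ] EuclideanSpace ℝ (Fin (m + 1))))
  have hd : ∀ x, HasFDerivAt (fun x => L (X (L.symm x))) (f' x) x := fun x =>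
    L.hasFDerivAt.comp x ((hX (L.symm x)).hasFDerivAt.comp x L.symm.hasFDerivAt)
  have hdiv : ∀ x, ∑ i, f' x (Pi.single i 1) i = vdiv X (WithLp.toLp 2 x) := by
    intro x
    rw [vdiv_eq_sum]
    rfl
  have hint' : Integrable (fun x : Fin (m + 1) → ℝ => vdiv X (WithLp.toLp 2 x)) :=
    (hmp.integrable_comp_emb hemb).2 hint
  have key := integral_divergence_of_hasFDerivAt_off_countable
    (fun _ => -S) (fun _ => S) (fun _ => by linarith) (fun x => L (X (L.symm x))) f' ∅
    Set.countable_empty (fun x _ => (hd x).continuousAt.continuousWithinAt) (fun x _ => hd x)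
    (by simp only [hdiv]; exact hint'.integrableOn)
  simp only [hdiv] at key
  rw [← hmp.integral_comp hemb, ← setIntegral_eq_integral_of_forall_compl_eq_zero (s :=
    Set.Icc (fun _ => -S) (fun _ => S)), key]
  · refine Finset.sum_eq_zero fun i _ => ?_
    have hface : ∀ c, |c| = S → ∀ x : Fin m → ℝ,
        L (X (L.symm (Fin.insertNth (α := fun _ => ℝ) i c x))) i = 0 := by
      intro c hc x
      rw [hvanish _ i]
      · simp
      · simpa [L, hc] using hS
    simp [hface S (abs_of_pos hS0), hface (-S) (by rw [abs_neg, abs_of_pos hS0])]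
  · intro x hx
    obtain ⟨i, hi⟩ : ∃ i, S < |x i| := by
      by_contra! h
      exact hx ⟨fun i => (abs_le.1 (h i)).1, fun i => (abs_le.1 (h i)).2⟩
    exact hdivvanish _ i (hS.trans hi)

/-- Young's inequality in the form `p a b^(p-1) ≤ a^p + (p-1) b^p`. -/
theorem mul_mul_rpow_sub_one_le_s4 {p a b : ℝ} (hp : 1 < p) (ha : 0 ≤ a) (hb : 0 ≤ b) :
    p * (a * b ^ (p - 1)) ≤ a ^ p + (p - 1) * b ^ p := by
  have hpq := Real.HolderConjugate.conjExponent hp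
  have h := Real.young_inequality_of_nonneg ha (Real.rpow_nonneg hb (p - 1)) hpq
  have hp0 : 0 < p := by linarith
  have hp1 : p - 1 ≠ 0 := by linarith
  rw [← Real.rpow_mul hb, Real.conjExponent, mul_div_cancel₀ _ hp1] at h
  calc p * (a * b ^ (p - 1)) ≤ p * (a ^ p / p + b ^ p / (p / (p - 1))) := by gcongr
    _ = a ^ p + (p - 1) * b ^ p := by field_simp

/-- The pointwise form of Picone's inequality. -/
theorem picone_inequality {E : Type*} [NormedAddCommGroup E] [InnerProductSpace ℝ E]
    {p t : ℝ} (hp : 1 < p) (ht : 0 ≤ t) (u v : E) :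
    p * t ^ (p - 1) * ⟪u, ‖v‖ ^ (p - 2) • v⟫ - (p - 1) * t ^ p * ⟪v, ‖v‖ ^ (p - 2) • v⟫
      ≤ ‖u‖ ^ p := by
  rcases eq_or_ne v 0 with rfl | hv
  · simpa using Real.rpow_nonneg (norm_nonneg u) p
  have hv0 : 0 < ‖v‖ := norm_pos_iff.2 hv
  have h1 : ‖v‖ ^ (p - 2) * ‖v‖ = ‖v‖ ^ (p - 1) := by
    rw [← Real.rpow_add_one hv0.ne']; ring_nf
  have h2 : ‖v‖ ^ (p - 1) * ‖v‖ = ‖v‖ ^ p := by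
    rw [← Real.rpow_add_one hv0.ne']; ring_nf
  have hvv : ⟪v, ‖v‖ ^ (p - 2) • v⟫ = ‖v‖ ^ p := by
    rw [inner_smul_right, real_inner_self_eq_norm_mul_norm, ← mul_assoc, h1, h2]
  have huv : ⟪u, ‖v‖ ^ (p - 2) • v⟫ ≤ ‖u‖ * ‖v‖ ^ (p - 1) := by
    rw [inner_smul_right, ← h1]
    calc ‖v‖ ^ (p - 2) * ⟪u, v⟫ ≤ ‖v‖ ^ (p - 2) * (‖u‖ * ‖v‖) := by
          gcongr
          exact real_inner_le_norm u v
      _ = ‖u‖ * (‖v‖ ^ (p - 2) * ‖v‖) := by ring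
  have hY := mul_mul_rpow_sub_one_le_s4 hp (norm_nonneg u) (mul_nonneg ht hv0.le)
  rw [Real.mul_rpow ht hv0.le, Real.mul_rpow ht hv0.le] at hY
  have h3 : p * t ^ (p - 1) * ⟪u, ‖v‖ ^ (p - 2) • v⟫ ≤
      p * t ^ (p - 1) * (‖u‖ * ‖v‖ ^ (p - 1)) := by gcongr
  rw [hvv]
  linarith

/-- Picone's inequality for the test function `φ^p η^(1-p)`. -/
theorem fderiv_rpow_mul_rpow_apply_le {E : Type*} [NormedAddCommGroup E] [InnerProductSpace ℝ E]
    [CompleteSpace E] {p : ℝ} (hp : 1 < p) {φ η : E → ℝ} {x : E}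
    (hφ : DifferentiableAt ℝ φ x) (hη : DifferentiableAt ℝ η x) (hφx : 0 ≤ φ x) (hηx : 0 < η x) :
    fderiv ℝ (fun y => φ y ^ p * η y ^ (1 - p)) x (‖gradient η x‖ ^ (p - 2) • gradient η x)
      ≤ ‖gradient φ x‖ ^ p := by
  have h := (hφ.hasFDerivAt.rpow_const (p := p) (Or.inr hp.le)).fun_mul
    (hη.hasFDerivAt.rpow_const (p := 1 - p) (Or.inl hηx.ne'))
  refine le_trans (le_of_eq ?_)
    (picone_inequality hp (div_nonneg hφx hηx.le) (gradient φ x) (gradient η x))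
  have e1 : (φ x / η x) ^ (p - 1) = φ x ^ (p - 1) * η x ^ (1 - p) := by
    rw [Real.div_rpow hφx hηx.le, div_eq_mul_inv, ← Real.rpow_neg hηx.le, neg_sub]
  have e2 : (φ x / η x) ^ p = φ x ^ p * η x ^ (1 - p - 1) := by
    rw [Real.div_rpow hφx hηx.le, div_eq_mul_inv, ← Real.rpow_neg hηx.le]
    ring_nf
  rw [HasFDerivAt.fderiv h, e1, e2, inner_gradient_left, inner_gradient_left]
  simp only [add_apply, smul_apply, smul_eq_mul]
  ring

/-- Euclidean p-Barta inequality (Euclidean case of Theorem 1.2). -/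
theorem euclidean_p_barta (n : ℕ) (hn : 1 ≤ n)
    (Ω : Set (EuclideanSpace ℝ (Fin n))) (hΩ : IsOpen Ω)
    (p : ℝ) (hp : 1 < p)
    (η : EuclideanSpace ℝ (Fin n) → ℝ)
    (hη : ContDiffOn ℝ 1 η Ω) (hηpos : ∀ x ∈ Ω, 0 < η x)
    (V : EuclideanSpace ℝ (Fin n) → EuclideanSpace ℝ (Fin n))
    (hV : V = fun y => ‖gradient η y‖ ^ (p - 2) • gradient η y)
    (hVdiff : ∀ x ∈ Ω, DifferentiableAt ℝ V x)
    (hdivcont : ContinuousOn (fun x => vdiv V x) Ω)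
    (lam : ℝ)
    (hbound : ∀ x ∈ Ω, -vdiv V x ≥ lam * (η x) ^ (p - 1))
    (φ : EuclideanSpace ℝ (Fin n) → ℝ) (hφ : ContDiff ℝ (⊤ : ℕ∞) φ)
    (hsupp : HasCompactSupport φ) (hsupΩ : tsupport φ ⊆ Ω) (hφnn : ∀ x, 0 ≤ φ x) :
    (∫ x in Ω, ‖gradient φ x‖ ^ p) ≥ lam * ∫ x in Ω, (φ x) ^ p := by
  have hp0 : 0 < p := by linarith
  have hφ1 : ContDiff ℝ 1 φ := hφ.of_le (by exact_mod_cast le_top)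
  set ψ : EuclideanSpace ℝ (Fin n) → ℝ := fun y => φ y ^ p * η y ^ (1 - p) with hψ
  have hφzero : ∀ x, x ∉ tsupport φ → φ x = 0 := fun x => image_eq_zero_of_notMem_tsupport
  have hgradzero : ∀ x, x ∉ tsupport φ → gradient φ x = 0 := fun x hx => by
    rw [gradient, fderiv_of_notMem_tsupport ℝ hx, map_zero]
  have hψzero : ∀ x, φ x = 0 → ψ x = 0 := fun x hx => by simp [hψ, hx, hp0.ne']
  have hψC1 : ContDiffOn ℝ 1 ψ Ω :=
    (hφ1.rpow_const_of_le (m := 1) (by exact_mod_cast hp.le)).contDiffOn.mul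
      (hη.rpow_const_of_ne fun x hx => (hηpos x hx).ne')
  have hψdiff : ∀ x ∈ Ω, DifferentiableAt ℝ ψ x := fun x hx =>
    (hψC1.differentiableOn one_ne_zero).differentiableAt (hΩ.mem_nhds hx)
  set W : EuclideanSpace ℝ (Fin n) → EuclideanSpace ℝ (Fin n) := fun y => ψ y • V y with hW
  have hWsupp : tsupport W ⊆ tsupport φ := closure_mono fun x hx hφx =>
    hx (by simp only [hW, hψzero x hφx, zero_smul])
  have hWdiff : Differentiable ℝ W := fun x => by
    by_cases hx : x ∈ tsupport φ
    · exact (hψdiff x (hsupΩ hx)).smul (hVdiff x (hsupΩ hx))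
    · exact (HasFDerivAt.of_notMem_tsupport ℝ fun h => hx (hWsupp h)).differentiableAt
  have hdivW : ∀ x ∈ Ω, vdiv W x = ψ x * vdiv V x + fderiv ℝ ψ x (V x) := fun x hx =>
    vdiv_smul (hψdiff x hx) (hVdiff x hx)
  have hdivWzero : ∀ x, x ∉ tsupport φ → vdiv W x = 0 := fun x hx =>
    vdiv_eq_zero_of_notMem_tsupport fun h => hx (hWsupp h)
  have hint : Integrable (fun x => vdiv W x) := by
    rw [← integrableOn_iff_integrable_of_support_subset (s := tsupport φ)
      fun x hx => by_contra fun h => hx (hdivWzero x h)]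
    refine ContinuousOn.integrableOn_compact hsupp.isCompact (ContinuousOn.mono ?_ hsupΩ)
    refine ContinuousOn.congr ?_ hdivW
    have hVcont : ContinuousOn V Ω := fun x hx => (hVdiff x hx).continuousAt.continuousWithinAt
    exact (hψC1.continuousOn.mul hdivcont).add
      ((hψC1.continuousOn_fderiv_of_isOpen hΩ le_rfl).clm_apply hVcont)
  have hzero : ∫ x, vdiv W x = 0 :=
    integral_vdiv_eq_zero hn hWdiff (hsupp.isCompact.of_isClosed_subset
      (isClosed_tsupport _) hWsupp) hint
  have hpoint : ∀ x, lam * φ x ^ p + vdiv W x ≤ ‖gradient φ x‖ ^ p := fun x => by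
    by_cases hx : x ∈ tsupport φ
    · have hxΩ := hsupΩ hx
      have hηx := hηpos x hxΩ
      have h1 := fderiv_rpow_mul_rpow_apply_le hp (hφ1.differentiable one_ne_zero x)
        ((hη.differentiableOn one_ne_zero).differentiableAt (hΩ.mem_nhds hxΩ)) (hφnn x) hηx
      have hVx : V x = ‖gradient η x‖ ^ (p - 2) • gradient η x := by rw [hV]
      rw [← hVx] at h1
      have hψnn : 0 ≤ ψ x := mul_nonneg (Real.rpow_nonneg (hφnn x) _) (Real.rpow_nonneg hηx.le _)
      have h2 : ψ x * (lam * η x ^ (p - 1)) ≤ ψ x * -vdiv V x :=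
        mul_le_mul_of_nonneg_left (hbound x hxΩ) hψnn
      have h3 : η x ^ (1 - p) * η x ^ (p - 1) = 1 := by
        rw [← Real.rpow_add hηx]; simp
      have h4 : ψ x * (lam * η x ^ (p - 1)) = lam * φ x ^ p := by
        linear_combination (lam * φ x ^ p) * h3
      rw [hdivW x hxΩ]
      linarith
    · rw [hdivWzero x hx, hφzero x hx, hgradzero x hx]
      simp [hp0.ne']
  have hφint : Integrable (fun x => φ x ^ p) :=
    (hφ1.continuous.rpow_const fun _ => Or.inr hp0.le).integrable_of_hasCompactSupport
      (hsupp.comp_left (g := fun s : ℝ => s ^ p) (Real.zero_rpow hp0.ne'))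
  have hgradcont : Continuous (gradient φ) :=
    (LinearIsometryEquiv.continuous _).comp (hφ1.continuous_fderiv one_ne_zero)
  have hgint : Integrable (fun x => ‖gradient φ x‖ ^ p) := by
    refine (hgradcont.norm.rpow_const fun _ => Or.inr hp0.le).integrable_of_hasCompactSupport ?_
    refine HasCompactSupport.intro hsupp.isCompact fun x hx => ?_
    simp [hgradzero x hx, hp0.ne']
  rw [setIntegral_eq_integral_of_forall_compl_eq_zero fun x hx => by
      simp [hgradzero x fun h => hx (hsupΩ h), hp0.ne'],
    setIntegral_eq_integral_of_forall_compl_eq_zero fun x hx => by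
      simp [hφzero x fun h => hx (hsupΩ h), hp0.ne']]
  calc lam * ∫ x, φ x ^ p = ∫ x, (lam * φ x ^ p + vdiv W x) := by
        rw [integral_add (hφint.const_mul lam) hint, integral_const_mul, hzero, add_zero]
    _ ≤ ∫ x, ‖gradient φ x‖ ^ p := integral_mono ((hφint.const_mul lam).add hint) hgint hpoint
end

section
/- Radial formula for the p-Laplacian in flat space: Let n ≥ 1, E = EuclideanSpace ℝ (Fin n), let p ≥ 2 be real, let x ∈ E with x ≠ 0, and set t := ‖x‖. Let ω : ℝ → ℝ be differentiable on a neighborhood of t with ω' differentiable at t (so ω''(t) exists). Define u := fun y => ω(‖y‖). Then the field fun y => ‖∇u y‖^(p−2) • ∇u y is differentiable at x and Δ_p u x = (p − 1) · |ω'(t)|^(p−2) · ω''(t) + ((n − 1)/t) · |ω'(t)|^(p−2) · ω'(t). -/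
open RealInnerProductSpace MeasureTheory

/-- Away from the origin the norm of an inner product space has derivative `⟪x, ·⟫ / ‖x‖`. -/
theorem hasFDerivAt_norm_of_ne_zero {F : Type*} [NormedAddCommGroup F] [InnerProductSpace ℝ F]
    {x : F} (hx : x ≠ 0) : HasFDerivAt (fun y : F => ‖y‖) (‖x‖⁻¹ • innerSL ℝ x) x := by
  have hnorm : ‖x‖ ≠ 0 := norm_ne_zero_iff.mpr hx
  have h := (hasStrictFDerivAt_norm_sq x).hasFDerivAt.sqrt (pow_ne_zero 2 hnorm)
  simp only [Real.sqrt_sq (norm_nonneg _)] at h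
  convert! h using 1
  ext v
  simp
  field_simp

/-- The gradient of a radial function `y ↦ f ‖y‖` away from the origin. -/
theorem hasGradientAt_comp_norm {F : Type*} [NormedAddCommGroup F] [InnerProductSpace ℝ F]
    [CompleteSpace F] {x : F} (hx : x ≠ 0) {f : ℝ → ℝ} {f' : ℝ} (hf : HasDerivAt f f' ‖x‖) :
    HasGradientAt (fun y : F => f ‖y‖) ((f' / ‖x‖) • x) x := by
  rw [hasGradientAt_iff_hasFDerivAt]
  convert! hf.comp_hasFDerivAt x (hasFDerivAt_norm_of_ne_zero hx) using 1
  ext v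
  simp
  ring

/-- The derivative of the odd power `s ↦ |s| ^ q * s`, including at `s = 0`. -/
theorem hasDerivAt_abs_rpow_mul_self {q : ℝ} (hq : 0 ≤ q) (s : ℝ) :
    HasDerivAt (fun r : ℝ => |r| ^ q * r) ((q + 1) * |s| ^ q) s := by
  rcases eq_or_ne s 0 with rfl | hs
  · rw [hasDerivAt_iff_tendsto_slope]
    have hval : (q + 1) * |(0 : ℝ)| ^ q = |(0 : ℝ)| ^ q := by
      rcases hq.eq_or_lt with rfl | hq
      · simp
      · simp [Real.zero_rpow hq.ne']
    rw [hval]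
    have hcont : Continuous fun r : ℝ => |r| ^ q :=
      continuous_abs.rpow_const fun _ => Or.inr hq
    refine (hcont.continuousAt.tendsto.mono_left nhdsWithin_le_nhds).congr' ?_
    filter_upwards [self_mem_nhdsWithin] with r hr
    have hr : r ≠ 0 := hr
    simp [slope_def_field, hr]
  · have habs : |s| ≠ 0 := abs_ne_zero.mpr hs
    convert! ((hasDerivAt_abs hs).rpow_const (p := q) (Or.inl habs)).mul (hasDerivAt_id s) using 1
    rw [Real.rpow_sub_one habs]
    have hsign : (SignType.sign s : ℝ) * s = |s| := sign_mul_self s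
    field_simp
    simp only [id]
    linear_combination (-q) * hsign

/-- A radial field `y ↦ h ‖y‖ • y` is differentiable away from the origin wherever `h` is, with
divergence `n * h ‖x‖ + ‖x‖ * h' ‖x‖`. -/
theorem differentiableAt_and_vdiv_norm_smul_self {n : ℕ} {x : EuclideanSpace ℝ (Fin n)}
    (hx : x ≠ 0) {h : ℝ → ℝ} {h' : ℝ} (hh : HasDerivAt h h' ‖x‖) :
    DifferentiableAt ℝ (fun y => h ‖y‖ • y) x ∧
      vdiv (fun y => h ‖y‖ • y) x = n * h ‖x‖ + ‖x‖ * h' := by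
  have hnorm : ‖x‖ ≠ 0 := norm_ne_zero_iff.mpr hx
  have key : HasFDerivAt (fun y => h ‖y‖ • y)
      (h ‖x‖ • ContinuousLinearMap.id ℝ (EuclideanSpace ℝ (Fin n)) +
        (h' / ‖x‖) • InnerProductSpace.rankOne ℝ x x) x := by
    convert! (hh.comp_hasFDerivAt x (hasFDerivAt_norm_of_ne_zero hx)).smul
      (hasFDerivAt_id x) using 1
    ext1 v
    simp [smul_smul, div_eq_mul_inv, mul_assoc]
  refine ⟨key.differentiableAt, ?_⟩
  rw [vdiv, key.fderiv]
  simp only [ContinuousLinearMap.toLinearMap_add, ContinuousLinearMap.toLinearMap_smul, map_add,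
    map_smul, InnerProductSpace.trace_rankOne, real_inner_self_eq_norm_sq,
    ContinuousLinearMap.coe_id, LinearMap.trace_id, finrank_euclideanSpace_fin, smul_eq_mul]
  field_simp

/-- Radial formula for the p-Laplacian in flat space. -/
theorem p_laplacian_radial (n : ℕ) (hn : 1 ≤ n) (p : ℝ) (hp : 2 ≤ p)
    (x : EuclideanSpace ℝ (Fin n)) (hx : x ≠ 0)
    (ω : ℝ → ℝ)
    (hω : ∀ᶠ s in nhds ‖x‖, DifferentiableAt ℝ ω s)
    (hω' : DifferentiableAt ℝ (deriv ω) ‖x‖) :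
    DifferentiableAt ℝ
        (fun y => ‖gradient (fun z => ω ‖z‖) y‖ ^ (p - 2) • gradient (fun z => ω ‖z‖) y) x ∧
      vdiv (fun y => ‖gradient (fun z => ω ‖z‖) y‖ ^ (p - 2) • gradient (fun z => ω ‖z‖) y) x =
        (p - 1) * |deriv ω ‖x‖| ^ (p - 2) * deriv (deriv ω) ‖x‖ +
          (((n : ℝ) - 1) / ‖x‖) * |deriv ω ‖x‖| ^ (p - 2) * deriv ω ‖x‖ := by
  have hnorm : ‖x‖ ≠ 0 := norm_ne_zero_iff.mpr hx
  set h : ℝ → ℝ := fun r => |deriv ω r| ^ (p - 2) * deriv ω r / r with hh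
  have hfield : (fun y => ‖gradient (fun z => ω ‖z‖) y‖ ^ (p - 2) • gradient (fun z => ω ‖z‖) y)
      =ᶠ[nhds x] fun y => h ‖y‖ • y := by
    filter_upwards [continuous_norm.continuousAt.eventually hω, isOpen_ne.mem_nhds hx]
      with y hy hy0
    have hy0 : ‖y‖ ≠ 0 := norm_ne_zero_iff.mpr hy0
    rw [(hasGradientAt_comp_norm (norm_ne_zero_iff.mp hy0) hy.hasDerivAt).gradient, norm_smul,
      norm_div, norm_norm, div_mul_cancel₀ _ hy0, smul_smul, ← mul_div_assoc, Real.norm_eq_abs]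
  have hderiv := ((hasDerivAt_abs_rpow_mul_self (sub_nonneg.mpr hp) (deriv ω ‖x‖)).comp ‖x‖
    hω'.hasDerivAt).div (hasDerivAt_id ‖x‖) hnorm
  obtain ⟨hdiff, hdiv⟩ := differentiableAt_and_vdiv_norm_smul_self (h := h) hx hderiv
  refine ⟨hdiff.congr_of_eventuallyEq hfield, ?_⟩
  rw [vdiv, hfield.fderiv_eq, ← vdiv, hdiv]
  simp only [hh, Function.comp_apply, id]
  field_simp
  ring
end

section
/- Expansion of the p-Laplacian via the Laplacian and the Hessian (identity (jorgekaushess) in flat space): Let E = EuclideanSpace ℝ (Fin n), let p ≥ 2 be real, and let x ∈ E. Let ψ : E → ℝ be differentiable on a neighborhood of x, suppose the gradient map fun y => ∇ψ y is differentiable at x, set H := fderiv ℝ (fun y => ∇ψ y) x (the Hessian of ψ at x), and assume ∇ψ(x) ≠ 0. Then the field fun y => ‖∇ψ y‖^(p−2) • ∇ψ y is differentiable at x and Δ_p ψ x = ‖∇ψ x‖^(p−2) · (trace of H) + (p − 2) · ‖∇ψ x‖^(p−4) · ⟪H (∇ψ x), ∇ψ x⟫. -/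
open RealInnerProductSpace MeasureTheory

/-- Away from zeros of `g`, the function `‖g‖ ^ q` is differentiable for every real exponent `q`. -/
theorem HasFDerivAt.norm_rpow_const {E F : Type*} [NormedAddCommGroup E] [NormedSpace ℝ E]
    [NormedAddCommGroup F] [InnerProductSpace ℝ F] {g : E → F} {g' : E →L[ℝ] F} {x : E}
    (hg : HasFDerivAt g g' x) (hne : g x ≠ 0) (q : ℝ) :
    HasFDerivAt (fun y => ‖g y‖ ^ q) ((q * ‖g x‖ ^ (q - 2)) • (innerSL ℝ (g x)).comp g') x := by
  have rpow_norm_sq (y : E) (r : ℝ) : (‖g y‖ ^ 2) ^ r = ‖g y‖ ^ (2 * r) := by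
    rw [← Real.rpow_natCast_mul (norm_nonneg _), Nat.cast_ofNat]
  have h := hg.norm_sq.rpow_const (p := q / 2) (Or.inl (by simpa using hne))
  simp only [rpow_norm_sq] at h
  convert h using 1
  · ext y
    congr 1
    ring
  · rw [show 2 * (q / 2 - 1) = q - 2 by ring, ← Nat.cast_smul_eq_nsmul ℝ, smul_smul]
    congr 1
    push_cast
    ring

/-- Expansion of the p-Laplacian via the Laplacian and the Hessian
(identity (jorgekaushess) in flat space). -/
theorem p_laplacian_hessian_expansion (n : ℕ) (p : ℝ) (hp : 2 ≤ p)
    (x : EuclideanSpace ℝ (Fin n))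
    (ψ : EuclideanSpace ℝ (Fin n) → ℝ)
    (hψ : ∀ᶠ y in nhds x, DifferentiableAt ℝ ψ y)
    (hgrad : DifferentiableAt ℝ (fun y => gradient ψ y) x)
    (hne : gradient ψ x ≠ 0) :
    DifferentiableAt ℝ (fun y => ‖gradient ψ y‖ ^ (p - 2) • gradient ψ y) x ∧
      vdiv (fun y => ‖gradient ψ y‖ ^ (p - 2) • gradient ψ y) x =
        ‖gradient ψ x‖ ^ (p - 2) *
            LinearMap.trace ℝ (EuclideanSpace ℝ (Fin n))
              (fderiv ℝ (fun y => gradient ψ y) x).toLinearMap +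
          (p - 2) * ‖gradient ψ x‖ ^ (p - 4) *
            ⟪(fderiv ℝ (fun y => gradient ψ y) x) (gradient ψ x), gradient ψ x⟫ := by
  have hg := hgrad.hasFDerivAt
  have hX := (hg.norm_rpow_const hne (p - 2)).fun_smul hg
  refine ⟨hX.differentiableAt, ?_⟩
  rw [vdiv, hX.fderiv]
  have toLinearMap_smulRight (f : EuclideanSpace ℝ (Fin n) →L[ℝ] ℝ)
      (v : EuclideanSpace ℝ (Fin n)) :
      (f.smulRight v).toLinearMap = f.toLinearMap.smulRight v := rfl
  rw [ContinuousLinearMap.toLinearMap_add, ContinuousLinearMap.toLinearMap_smul,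
    toLinearMap_smulRight, map_add, map_smul, LinearMap.trace_smulRight, real_inner_comm,
    show p - 4 = p - 2 - 2 by ring]
  simp
end

section
/- Negativity of the derivative of the radial model eigenfunction: Let m : ℕ with m ≥ 1, let p > 1 and λ > 0 and r > 0 be real numbers, and let ω : ℝ → ℝ be continuous on [0, r) with ω(s) > 0 for all s ∈ [0, r), and differentiable on (0, r). Suppose that for every t ∈ (0, r), t^(m−1) · |ω'(t)|^(p−2) · ω'(t) = −λ · ∫_0^t s^(m−1) · (ω s)^(p−1) ds. Then ω'(t) < 0 for every t ∈ (0, r). -/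
open MeasureTheory

/-- Negativity of the derivative of the radial model eigenfunction. -/
theorem radial_eigenfunction_deriv_neg (m : ℕ) (hm : 1 ≤ m)
    (p lam r : ℝ) (hp : 1 < p) (hlam : 0 < lam) (hr : 0 < r)
    (ω : ℝ → ℝ)
    (hcont : ContinuousOn ω (Set.Ico 0 r))
    (hpos : ∀ s ∈ Set.Ico (0 : ℝ) r, 0 < ω s)
    (hdiff : DifferentiableOn ℝ ω (Set.Ioo 0 r))
    (heq : ∀ t ∈ Set.Ioo (0 : ℝ) r,
      t ^ (m - 1) * |deriv ω t| ^ (p - 2) * deriv ω t =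
        -lam * ∫ s in Set.Ioo (0 : ℝ) t, s ^ (m - 1) * (ω s) ^ (p - 1)) :
    ∀ t ∈ Set.Ioo (0 : ℝ) r, deriv ω t < 0 := by
  intro t ht
  have hint : 0 < ∫ s in Set.Ioo (0 : ℝ) t, s ^ (m - 1) * (ω s) ^ (p - 1) := by
    rw [← integral_Ioc_eq_integral_Ioo, ← intervalIntegral.integral_of_le ht.1.le]
    have hsub : Set.Icc 0 t ⊆ Set.Ico 0 r := Set.Icc_subset_Ico_right ht.2
    refine intervalIntegral.intervalIntegral_pos_of_pos_on ?_ (fun s hs => ?_) ht.1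
    · refine ContinuousOn.intervalIntegrable_of_Icc ht.1.le ?_
      exact (continuousOn_pow _).mul ((hcont.mono hsub).rpow_const
        fun s hs => Or.inl (hpos s (hsub hs)).ne')
    · exact mul_pos (pow_pos hs.1 _)
        (Real.rpow_pos_of_pos (hpos s (hsub (Set.Ioo_subset_Icc_self hs))) _)
  have hneg : t ^ (m - 1) * |deriv ω t| ^ (p - 2) * deriv ω t < 0 := by
    rw [heq t ht]
    exact mul_neg_of_neg_of_pos (neg_lt_zero.mpr hlam) hint
  exact neg_of_mul_neg_right hneg
    (mul_nonneg (pow_nonneg ht.1.le _) (Real.rpow_nonneg (abs_nonneg _) _))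
end

section
/- Auxiliary ODE satisfied by the spherical comparison function V₁ (identity (modelsheric2)): Let m : ℕ with m ≥ 1, let p > 1 and λ be real numbers, set q := p + m − 2 (so q > 0) and k := λ / q, and define V₁ : ℝ → ℝ by V₁ s := (Real.cos s)^(−k) (a real power). Then (i) for every t ∈ (−π/2, π/2), deriv V₁ t = k · Real.tan t · V₁ t; and (ii) for every t ∈ (0, π/2), the function fun s => (Real.sin s)^(m−1) * deriv V₁ s has derivative at t equal to λ · (Real.sin t)^(m−1) · ( m/q + (Real.tan t)² · (1 + λ/q) / q ) · V₁ t. -/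
/-- On the interval where `cos` is positive, `cos ^ (-k)` has logarithmic derivative `k * tan`. -/
theorem hasDerivAt_cos_rpow_neg (k : ℝ) {t : ℝ}
    (ht : t ∈ Set.Ioo (-(Real.pi / 2)) (Real.pi / 2)) :
    HasDerivAt (fun s => Real.cos s ^ (-k)) (k * Real.tan t * Real.cos t ^ (-k)) t := by
  have hc : 0 < Real.cos t := Real.cos_pos_of_mem_Ioo ht
  convert (Real.hasDerivAt_cos t).rpow_const (p := -k) (Or.inl hc.ne') using 1
  rw [Real.rpow_sub_one hc.ne', Real.tan_eq_sin_div_cos]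
  field_simp

/-- Auxiliary ODE satisfied by the spherical comparison function `V₁`
(identity (modelsheric2)). -/
theorem spherical_comparison_ode (m : ℕ) (hm : 1 ≤ m) (p lam : ℝ) (hp : 1 < p)
    (q : ℝ) (hq : q = p + m - 2) (k : ℝ) (hk : k = lam / q)
    (V₁ : ℝ → ℝ) (hV₁ : V₁ = fun s => Real.cos s ^ (-k)) :
    (∀ t ∈ Set.Ioo (-(Real.pi / 2)) (Real.pi / 2),
        deriv V₁ t = k * Real.tan t * V₁ t) ∧
      (∀ t ∈ Set.Ioo 0 (Real.pi / 2),
        HasDerivAt (fun s => Real.sin s ^ (m - 1) * deriv V₁ s)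
          (lam * Real.sin t ^ (m - 1) *
            ((m : ℝ) / q + Real.tan t ^ 2 * (1 + lam / q) / q) * V₁ t) t) := by
  have hV : ∀ t ∈ Set.Ioo (-(Real.pi / 2)) (Real.pi / 2),
      HasDerivAt V₁ (k * Real.tan t * V₁ t) t := by
    subst hV₁
    exact fun t ht => hasDerivAt_cos_rpow_neg k ht
  refine ⟨fun t ht => (hV t ht).deriv, fun t ht => ?_⟩
  have ht' : t ∈ Set.Ioo (-(Real.pi / 2)) (Real.pi / 2) :=
    ⟨by linarith [ht.1, Real.pi_pos], ht.2⟩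
  have hc : Real.cos t ≠ 0 := (Real.cos_pos_of_mem_Ioo ht').ne'
  have hderiv : (fun s => Real.sin s ^ (m - 1) * deriv V₁ s) =ᶠ[nhds t]
      fun s => Real.sin s ^ (m - 1) * (k * Real.tan s * V₁ s) := by
    filter_upwards [isOpen_Ioo.mem_nhds ht'] with s hs
    rw [(hV s hs).deriv]
  refine HasDerivAt.congr_of_eventuallyEq ?_ hderiv
  have hprod := ((Real.hasDerivAt_sin t).pow (m - 1)).mul
    (((Real.hasDerivAt_tan hc).const_mul k).mul (hV t ht'))
  refine hprod.congr_deriv ?_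
  have hsec : 1 / Real.cos t ^ 2 = 1 + Real.tan t ^ 2 := by
    rw [one_div, ← Real.inv_one_add_tan_sq hc, inv_inv]
  have hpow : ((m - 1 : ℕ) : ℝ) * Real.sin t ^ (m - 1 - 1) * Real.cos t * Real.tan t =
      ((m : ℝ) - 1) * Real.sin t ^ (m - 1) := by
    obtain ⟨n, rfl⟩ := Nat.exists_eq_add_of_le' hm
    rw [mul_assoc, mul_comm (Real.cos t), Real.tan_mul_cos hc]
    cases n with
    | zero => simp
    | succ n => simp [pow_succ, mul_assoc]
  have hrhs : lam * Real.sin t ^ (m - 1) *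
      ((m : ℝ) / q + Real.tan t ^ 2 * (1 + lam / q) / q) * V₁ t =
      k * Real.sin t ^ (m - 1) * (m + Real.tan t ^ 2 * (1 + k)) * V₁ t := by
    rw [hk]
    ring
  rw [hrhs, hsec]
  simp only [Pi.pow_apply, Pi.mul_apply]
  linear_combination k * V₁ t * hpow
end

section
/- Sturm–Picone type Wronskian derivative identity (the computation underlying identities (flateq), (identitysheprical) and (identityhiperbolic)): Let p > 1 be real, let I ⊆ ℝ be an open interval, let λ ∈ ℝ, and let μ, w, u, V : ℝ → ℝ. Assume u and V are differentiable on I with u(s) > 0 for all s ∈ I. Define g := fun s => w s · |deriv u s|^(p−2) · deriv u s and h := fun s => w s · deriv V s, and assume that for every t ∈ I, g has derivative −λ · w t · (u t)^(p−1) at t and h has derivative −μ t · w t · V t at t. Then for every t ∈ I, the function W := fun s => h s · (u s)^(p−1) − V s · g s has derivative at t equal to w t · ( (λ − μ t) · V t · (u t)^(p−1) + deriv V t · deriv u t · ( (p − 1) · (u t)^(p−2) − |deriv u t|^(p−2) ) ). -/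
/-- Sturm–Picone type Wronskian derivative identity (the computation underlying
identities (flateq), (identitysheprical) and (identityhiperbolic)). -/
theorem sturm_picone_wronskian (p : ℝ) (hp : 1 < p) (a b : ℝ) (lam : ℝ)
    (μ w u V : ℝ → ℝ)
    (hu : DifferentiableOn ℝ u (Set.Ioo a b))
    (hV : DifferentiableOn ℝ V (Set.Ioo a b))
    (hupos : ∀ s ∈ Set.Ioo a b, 0 < u s)
    (hg : ∀ t ∈ Set.Ioo a b,
      HasDerivAt (fun s => w s * |deriv u s| ^ (p - 2) * deriv u s)
        (-lam * w t * (u t) ^ (p - 1)) t)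
    (hh : ∀ t ∈ Set.Ioo a b,
      HasDerivAt (fun s => w s * deriv V s) (-(μ t) * w t * V t) t) :
    ∀ t ∈ Set.Ioo a b,
      HasDerivAt
        (fun s => (w s * deriv V s) * (u s) ^ (p - 1) -
          V s * (w s * |deriv u s| ^ (p - 2) * deriv u s))
        (w t * ((lam - μ t) * V t * (u t) ^ (p - 1) +
          deriv V t * deriv u t * ((p - 1) * (u t) ^ (p - 2) - |deriv u t| ^ (p - 2)))) t := by
  intro t ht
  have hmem : Set.Ioo a b ∈ nhds t := isOpen_Ioo.mem_nhds ht
  have hu' : HasDerivAt u (deriv u t) t := (hu.differentiableAt hmem).hasDerivAt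
  have hV' : HasDerivAt V (deriv V t) t := (hV.differentiableAt hmem).hasDerivAt
  have hpow : HasDerivAt (fun s => u s ^ (p - 1)) (deriv u t * (p - 1) * u t ^ (p - 2)) t := by
    convert hu'.rpow_const (p := p - 1) (Or.inl (hupos t ht).ne') using 3
    ring
  refine (((hh t ht).mul hpow).sub (hV'.mul (hg t ht))).congr_deriv ?_
  ring
end
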